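/- arXiv:2111.01638 — 3 statements merged into one kernel-verified Lean document; each statement's English description precedes it below -/
import Mathlib

section
/- Let G be a finite normal-form game, let σ ∈ Σ, and let P = { τ ∈ Σ : τ is completely mixed and for all players n and all s_n ∈ S_n, G_n(σ_n, τ_{-n}) ≥ G_n(s_n, τ_{-n}) }. Suppose P is convex and nonempty and σ belongs to the closure of P. Then for any τ* ∈ P, the linear polynomial strategy-profile η(t) = (1−t)σ + tτ* satisfies: η_{n,s_n} > 0 for every n and s_n ∈ S_n, o(η) ≤ 1, η(0) = σ, and for every non-negative integer K, σ_n is a best reply of order K against η for each player n. -/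
namespace GamePE

variable {N : ℕ}

/-- A (not necessarily mixed) strategy profile. -/
abbrev Profile (S : Fin N → Type) := ∀ n, S n → ℝ

/-- τ is a profile of mixed strategies. -/
def IsMixed {S : Fin N → Type} [∀ n, Fintype (S n)] (τ : Profile S) : Prop :=
  ∀ n, (∀ s, 0 ≤ τ n s) ∧ (∑ s, τ n s) = 1

/-- τ is completely mixed. -/
def CompletelyMixed {S : Fin N → Type} (τ : Profile S) : Prop := ∀ n s, 0 < τ n s

/-- The pure strategy sn viewed as a mixed strategy. -/
def pureStrat {S : Fin N → Type} [∀ n, DecidableEq (S n)] {n : Fin N} (sn : S n) : S n → ℝ :=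
  fun s => if s = sn then 1 else 0

/-- The multilinear extension of player n's payoff. -/
noncomputable def payoff {S : Fin N → Type} [∀ n, Fintype (S n)]
    (G : Fin N → (∀ m, S m) → ℝ) (n : Fin N) (τ : Profile S) : ℝ :=
  ∑ s : ∀ m, S m, (∏ m, τ m (s m)) * G n s

/-- σ is a perfect equilibrium of the game G. -/
noncomputable def IsPerfect {S : Fin N → Type} [∀ n, Fintype (S n)] [∀ n, DecidableEq (S n)]
    (G : Fin N → (∀ m, S m) → ℝ) (σ : Profile S) : Prop :=
  ∃ σk : ℕ → Profile S,
    (∀ k, IsMixed (σk k) ∧ CompletelyMixed (σk k)) ∧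
    Filter.Tendsto σk Filter.atTop (nhds σ) ∧
    (∀ (k : ℕ) (n : Fin N) (sn : S n),
      payoff G n (Function.update (σk k) n (σ n)) ≥
        payoff G n (Function.update (σk k) n (pureStrat sn)))

/-- ϱ is an LPS profile of order K : each level of each player is a probability distribution. -/
def IsLPSProfile {S : Fin N → Type} [∀ n, Fintype (S n)] {K : ℕ}
    (ϱ : ∀ n, Fin (K+1) → S n → ℝ) : Prop :=
  ∀ n k, (∀ s, 0 ≤ ϱ n k s) ∧ (∑ s, ϱ n k s) = 1

/-- Full support for an LPS profile. -/
def FullSupport {S : Fin N → Type} {K : ℕ} (ϱ : ∀ n, Fin (K+1) → S n → ℝ) : Prop :=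
  ∀ n, ∀ s : S n, ∃ k, ϱ n k s ≠ 0

/-- ℓ(ϱ) : the max over the players of the first level at which the union of supports is everything. -/
noncomputable def lpsLevel {S : Fin N → Type} [∀ n, Fintype (S n)] {K : ℕ}
    (ϱ : ∀ n, Fin (K+1) → S n → ℝ) : ℕ :=
  Finset.univ.sup fun n =>
    sInf {k : ℕ | ∀ s : S n, ∃ i : Fin (K+1), (i : ℕ) ≤ k ∧ ϱ n i s ≠ 0}

/-- Combine a pure strategy of player n with a pure strategy profile of the others. -/
def combine {S : Fin N → Type} (n : Fin N) (sn : S n)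
    (so : ∀ m : {m : Fin N // m ≠ n}, S m.val) : ∀ m, S m :=
  fun m => if h : m = n then cast (congrArg S h.symm) sn else so ⟨m, h⟩

/-- Unnormalized induced beliefs of player n at level k. -/
noncomputable def ubelief {S : Fin N → Type} [∀ n, Fintype (S n)] {K : ℕ}
    (ϱ : ∀ n, Fin (K+1) → S n → ℝ) (n : Fin N) (k : ℕ)
    (so : ∀ m : {m : Fin N // m ≠ n}, S m.val) : ℝ :=
  ∑ kv ∈ Finset.univ.filter
      (fun kv : {m : Fin N // m ≠ n} → Fin (K+1) => (∑ m, ((kv m : ℕ))) = k),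
    ∏ m : {m : Fin N // m ≠ n}, ϱ m.val (kv m) (so m)

/-- Induced beliefs μ_n^k of player n at level k (normalized). -/
noncomputable def belief {S : Fin N → Type} [∀ n, Fintype (S n)] {K : ℕ}
    (ϱ : ∀ n, Fin (K+1) → S n → ℝ) (n : Fin N) (k : ℕ)
    (so : ∀ m : {m : Fin N // m ≠ n}, S m.val) : ℝ :=
  (∑ so' : ∀ m : {m : Fin N // m ≠ n}, S m.val, ubelief ϱ n k so')⁻¹ * ubelief ϱ n k so

/-- Expected payoff of player n playing τn against a belief μ over the opponents' profiles. -/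
noncomputable def beliefPayoff {S : Fin N → Type} [∀ n, Fintype (S n)]
    (G : Fin N → (∀ m, S m) → ℝ) (n : Fin N) (τn : S n → ℝ)
    (μ : (∀ m : {m : Fin N // m ≠ n}, S m.val) → ℝ) : ℝ :=
  ∑ so : ∀ m : {m : Fin N // m ≠ n}, S m.val, ∑ sn : S n,
    μ so * τn sn * G n (combine n sn so)

/-- Lexicographic comparison of the first k+1 entries (indices 0,…,k) of two sequences. -/
def lexGe (k : ℕ) (a b : ℕ → ℝ) : Prop :=
  (∀ i ≤ k, a i = b i) ∨ ∃ i ≤ k, (∀ j < i, a j = b j) ∧ b i < a i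

/-- τn is a best reply of order k against the LPS profile ϱ. -/
noncomputable def lpsBestReply {S : Fin N → Type} [∀ n, Fintype (S n)] [∀ n, DecidableEq (S n)]
    (G : Fin N → (∀ m, S m) → ℝ) {K : ℕ} (ϱ : ∀ n, Fin (K+1) → S n → ℝ)
    (n : Fin N) (τn : S n → ℝ) (k : ℕ) : Prop :=
  ∀ sn : S n,
    lexGe k (fun i => beliefPayoff G n τn (belief ϱ n i))
            (fun i => beliefPayoff G n (pureStrat sn) (belief ϱ n i))

/-- A polynomial strategy profile. -/
abbrev PolyProfile (S : Fin N → Type) := ∀ n, S n → Polynomial ℝ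

/-- f > 0 for a univariate real polynomial: the trailing (lowest-order) coefficient is positive. -/
def polyPos (f : Polynomial ℝ) : Prop := 0 < f.trailingCoeff

/-- f ≥ 0 : f is identically zero or its trailing coefficient is positive. -/
def polyNonneg (f : Polynomial ℝ) : Prop := f = 0 ∨ 0 < f.trailingCoeff

/-- The order o(η) of a polynomial strategy profile (∞ if some coordinate is zero). -/
noncomputable def polyOrder {S : Fin N → Type} [∀ n, Fintype (S n)]
    (η : PolyProfile S) : ℕ∞ :=
  Finset.univ.sup fun p : Σ n, S n => (η p.1 p.2).trailingDegree

/-- The polynomial t ↦ G_n(τn, η_{-n}(t)). -/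
noncomputable def payoffPoly {S : Fin N → Type} [∀ n, Fintype (S n)]
    (G : Fin N → (∀ m, S m) → ℝ) (η : PolyProfile S) (n : Fin N) (τn : S n → ℝ) :
    Polynomial ℝ :=
  ∑ s : ∀ m, S m,
    (Polynomial.C (τn (s n)) * ∏ m ∈ Finset.univ.erase n, η m (s m)) * Polynomial.C (G n s)

/-- τn is a best reply of order r against the polynomial strategy profile η. -/
noncomputable def polyBestReply {S : Fin N → Type} [∀ n, Fintype (S n)] [∀ n, DecidableEq (S n)]
    (G : Fin N → (∀ m, S m) → ℝ) (η : PolyProfile S) (n : Fin N) (τn : S n → ℝ) (r : ℕ) : Prop :=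
  ∀ sn : S n,
    polyNonneg (payoffPoly G η n τn - payoffPoly G η n (pureStrat sn)) ∨
    ((r + 1 : ℕ) : ℕ∞) ≤ (payoffPoly G η n τn - payoffPoly G η n (pureStrat sn)).trailingDegree


/-- A real polynomial that is nonnegative on `(0, 1)` is zero or has positive trailing
coefficient. -/
theorem polyNonneg_of_eval_nonneg (f : Polynomial ℝ)
    (h : ∀ t ∈ Set.Ioo (0 : ℝ) 1, 0 ≤ f.eval t) : polyNonneg f := by
  by_cases hf : f = 0
  · exact Or.inl hf
  right
  obtain ⟨g, hg⟩ : Polynomial.X ^ f.natTrailingDegree ∣ f :=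
    Polynomial.X_pow_dvd_iff.2 fun d hd => Polynomial.coeff_eq_zero_of_lt_natTrailingDegree hd
  have hc : f.trailingCoeff = g.eval 0 := by
    have hcoeff := Polynomial.coeff_X_pow_mul g f.natTrailingDegree 0
    rwa [← hg, zero_add, Polynomial.coeff_zero_eq_eval_zero] at hcoeff
  have hne : f.trailingCoeff ≠ 0 := Polynomial.trailingCoeff_nonzero_iff_nonzero.2 hf
  refine lt_of_le_of_ne ?_ hne.symm
  rw [hc]
  have hlim : Filter.Tendsto (fun t => g.eval t) (nhdsWithin (0 : ℝ) (Set.Ioi 0))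
      (nhds (g.eval 0)) := (g.continuous.tendsto 0).mono_left nhdsWithin_le_nhds
  refine ge_of_tendsto hlim ?_
  filter_upwards [Ioo_mem_nhdsGT (zero_lt_one' ℝ)] with t ht
  have h0 := h t ht
  rw [hg, Polynomial.eval_mul, Polynomial.eval_pow, Polynomial.eval_X] at h0
  exact nonneg_of_mul_nonneg_right h0 (pow_pos ht.1 _)

/-- Evaluating `payoffPoly` at `t` gives the payoff against the evaluated profile. -/
theorem eval_payoffPoly {S : Fin N → Type} [∀ n, Fintype (S n)]
    (G : Fin N → (∀ m, S m) → ℝ) (η : PolyProfile S) (n : Fin N) (τn : S n → ℝ) (t : ℝ) :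
    (payoffPoly G η n τn).eval t =
      payoff G n (Function.update (fun m s => (η m s).eval t) n τn) := by
  simp only [payoffPoly, payoff, Polynomial.eval_finsetSum, Polynomial.eval_mul,
    Polynomial.eval_C, Polynomial.eval_prod]
  refine Finset.sum_congr rfl fun s _ => ?_
  rw [← Finset.mul_prod_erase Finset.univ _ (Finset.mem_univ n), Function.update_self]
  congr 2
  refine Finset.prod_congr rfl fun m hm => ?_
  rw [Function.update_of_ne (Finset.ne_of_mem_erase hm)]

/-- The payoff function is continuous in the strategy profile. -/
theorem continuous_payoff {S : Fin N → Type} [∀ n, Fintype (S n)]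
    (G : Fin N → (∀ m, S m) → ℝ) (n : Fin N) : Continuous (payoff G n) := by
  unfold payoff
  fun_prop

/-- if P is convex, the segment from σ to any τ* ∈ P gives a suitable
linear polynomial strategy-profile. -/
theorem stmt7 {N : ℕ} (S : Fin N → Type) [∀ n, Fintype (S n)]
    [∀ n, DecidableEq (S n)] [∀ n, Nonempty (S n)]
    (G : Fin N → (∀ m, S m) → ℝ) (σ : Profile S) (hσ : IsMixed σ)
    (P : Set (Profile S))
    (hP : P = {τ | IsMixed τ ∧ CompletelyMixed τ ∧ ∀ n (sn : S n),
      payoff G n (Function.update τ n (σ n)) ≥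
        payoff G n (Function.update τ n (pureStrat sn))})
    (hconv : Convex ℝ P) (hne : P.Nonempty) (hσcl : σ ∈ closure P)
    (τs : Profile S) (hτs : τs ∈ P) :
    let η : PolyProfile S := fun n sn =>
      Polynomial.C (σ n sn) + Polynomial.C (τs n sn - σ n sn) * Polynomial.X
    (∀ n (sn : S n), polyPos (η n sn)) ∧
    polyOrder η ≤ (1 : ℕ∞) ∧
    (∀ n (sn : S n), (η n sn).eval 0 = σ n sn) ∧
    (∀ (K : ℕ) (n : Fin N), polyBestReply G η n (σ n) K) := by
  intro η
  have hP' : τs ∈ P := hτs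
  rw [hP] at hP'
  obtain ⟨-, hpos, -⟩ := hP'
  have hη0 : ∀ n sn, (η n sn).coeff 0 = σ n sn := fun n sn => by simp [η]
  have hη1 : ∀ n sn, (η n sn).coeff 1 = τs n sn - σ n sn := fun n sn => by
    simp [η, Polynomial.coeff_C]
  refine ⟨fun n sn => ?_, ?_, fun n sn => by simp [η], fun K n sn => Or.inl ?_⟩
  · have hev : ∀ t ∈ Set.Ioo (0 : ℝ) 1, 0 < (η n sn).eval t := fun t ht => by
      have h1 : (η n sn).eval t = (1 - t) * σ n sn + t * τs n sn := by
        simp only [η, Polynomial.eval_add, Polynomial.eval_mul, Polynomial.eval_C,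
          Polynomial.eval_X]
        ring
      rw [h1]
      have h2 := mul_nonneg (sub_nonneg.2 ht.2.le) ((hσ n).1 sn)
      have h3 := mul_pos ht.1 (hpos n sn)
      linarith
    refine (polyNonneg_of_eval_nonneg _ fun t ht => (hev t ht).le).resolve_left fun h0 => ?_
    have h1 := hev (1 / 2) (by norm_num)
    simp [h0] at h1
  · refine Finset.sup_le fun p _ => ?_
    by_cases h : σ p.1 p.2 = 0
    · refine Polynomial.trailingDegree_le_of_ne_zero (n := 1) ?_
      rw [hη1, h, sub_zero]
      exact (hpos _ _).ne'
    · exact (Polynomial.trailingDegree_le_of_ne_zero (n := 0) (by rwa [hη0])).trans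
        (by simp)
  · refine polyNonneg_of_eval_nonneg _ fun t ht => ?_
    rw [Polynomial.eval_sub, eval_payoffPoly, eval_payoffPoly, sub_nonneg]
    have hη : (fun m s => (η m s).eval t) = (1 - t) • σ + t • τs := by
      funext m s
      simp only [η, Polynomial.eval_add, Polynomial.eval_mul, Polynomial.eval_C,
        Polynomial.eval_X, Pi.add_apply, Pi.smul_apply, smul_eq_mul]
      ring
    rw [hη]
    have hcont : ∀ ρ : S n → ℝ, Continuous fun τ : Profile S =>
        payoff G n (Function.update ((1 - t) • τ + t • τs) n ρ) := fun ρ =>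
      (continuous_payoff G n).comp
        (Continuous.update (by fun_prop) n continuous_const)
    refine closure_minimal (fun τ hτ => ?_)
      (isClosed_le (hcont (pureStrat sn)) (hcont (σ n))) hσcl
    have hmem := hconv hτ hτs (sub_nonneg.2 ht.2.le) ht.1.le (sub_add_cancel 1 t)
    rw [hP] at hmem
    exact hmem.2.2 n sn

end GamePE
end

section
/- Let G be a finite normal-form game with N ≥ 2 players, and set κ = Σ_n |S_n|, d = N−1, Z = (2d+6)(2d+5)^{κ−1}, D = 5(κ(2d+4)+2)·Z, ℒ = d·(6d−3)^{2κ−1}, ℓ = 2d(ZD)^2(1+Z) and K = ℒ·ℓ. Let σ ∈ Σ. If there exists a polynomial strategy-profile η : ℝ → ∏_n ℝ^{S_n} such that η_{n,s_n} > 0 for all n and s_n ∈ S_n, o(η) ≤ ℓ, η(0) = σ, and σ_n is a best reply of order K against η for each player n, then σ is a perfect equilibrium of G. -/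
namespace GamePE

variable {N : ℕ}

section Filtration

variable {ι A : Type*} [Fintype ι] [CommRing A] {y : ι → A} {s : A}

/-- The monomial `y ^ a * s ^ b`. -/
def mono (y : ι → A) (s : A) (a : ι → ℕ) (b : ℕ) : A := (∏ j, y j ^ a j) * s ^ b

lemma mono_mul (a a' : ι → ℕ) (b b' : ℕ) :
    mono y s a b * mono y s a' b' = mono y s (a + a') (b + b') := by
  simp only [mono, Pi.add_apply, pow_add, Finset.prod_mul_distrib]
  ring

variable [Algebra ℝ A]

/-- The span of the monomials `y ^ a * s ^ b` with `|a| ≤ k` and `|a| + b ≤ T`. -/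
def filt (y : ι → A) (s : A) (k T : ℕ) : Submodule ℝ A :=
  Submodule.span ℝ {g | ∃ (a : ι → ℕ) (b : ℕ), ∑ j, a j ≤ k ∧ ∑ j, a j + b ≤ T ∧ g = mono y s a b}

lemma mono_mem_filt {a : ι → ℕ} {b k T : ℕ} (h₁ : ∑ j, a j ≤ k) (h₂ : ∑ j, a j + b ≤ T) :
    mono y s a b ∈ filt y s k T :=
  Submodule.subset_span ⟨a, b, h₁, h₂, rfl⟩

lemma filt_mono {k k' T T' : ℕ} (hk : k ≤ k') (hT : T ≤ T') : filt y s k T ≤ filt y s k' T' := by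
  apply Submodule.span_mono
  rintro g ⟨a, b, h₁, h₂, rfl⟩
  exact ⟨a, b, h₁.trans hk, h₂.trans hT, rfl⟩

lemma mem_filt_of_le {k k' T T' : ℕ} {g : A} (hg : g ∈ filt y s k T) (hk : k ≤ k') (hT : T ≤ T') :
    g ∈ filt y s k' T' :=
  filt_mono hk hT hg

lemma mul_mem_filt {k k' T T' : ℕ} {g g' : A} (hg : g ∈ filt y s k T) (hg' : g' ∈ filt y s k' T') :
    g * g' ∈ filt y s (k + k') (T + T') := by
  have h : filt y s k T * filt y s k' T' ≤ filt y s (k + k') (T + T') := by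
    rw [filt, filt, Submodule.span_mul_span, Submodule.span_le]
    rintro _ ⟨_, ⟨a, b, h₁, h₂, rfl⟩, _, ⟨a', b', h₁', h₂', rfl⟩, rfl⟩
    refine Submodule.subset_span ⟨a + a', b + b', ?_, ?_, mono_mul _ _ _ _⟩
    · simp only [Pi.add_apply, Finset.sum_add_distrib]; omega
    · simp only [Pi.add_apply, Finset.sum_add_distrib]; omega
  exact h (Submodule.mul_mem_mul hg hg')

lemma one_mem_filt (k T : ℕ) : (1 : A) ∈ filt y s k T := by
  have := mono_mem_filt (y := y) (s := s) (a := 0) (b := 0) (k := k) (T := T) (by simp) (by simp)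
  simpa [mono] using this

lemma algebraMap_mem_filt (k T : ℕ) (r : ℝ) : algebraMap ℝ A r ∈ filt y s k T := by
  rw [Algebra.algebraMap_eq_smul_one]
  exact Submodule.smul_mem _ _ (one_mem_filt k T)

lemma coord_mem_filt [DecidableEq ι] (j : ι) : y j ∈ filt y s 1 1 := by
  have := mono_mem_filt (y := y) (s := s) (a := Pi.single j 1) (b := 0) (k := 1) (T := 1)
    (by simp) (by simp)
  simpa [mono, Pi.single_apply, pow_ite, Finset.prod_ite_eq'] using this

lemma param_mem_filt : s ∈ filt y s 0 1 := by
  have := mono_mem_filt (y := y) (s := s) (a := 0) (b := 1) (k := 0) (T := 1) (by simp) (by simp)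
  simpa [mono] using this

lemma pow_mem_filt {k T : ℕ} {g : A} (hg : g ∈ filt y s k T) (n : ℕ) :
    g ^ n ∈ filt y s (n * k) (n * T) := by
  induction n with
  | zero => simpa using one_mem_filt 0 0
  | succ n ih =>
    rw [pow_succ, Nat.succ_mul, Nat.succ_mul]
    exact mul_mem_filt ih hg

lemma aeval_mem_filt {f : MvPolynomial ι ℝ} {k : ℕ} (hf : f.totalDegree ≤ k) :
    MvPolynomial.aeval y f ∈ filt y s k k := by
  rw [MvPolynomial.aeval_def, MvPolynomial.eval₂_eq']
  refine Submodule.sum_mem _ fun m hm => ?_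
  rw [← Algebra.smul_def]
  refine Submodule.smul_mem _ _ ?_
  have hdeg : ∑ j, m j ≤ k := by
    have h := MvPolynomial.le_totalDegree hm
    rw [Finsupp.sum_fintype _ _ (fun _ => rfl)] at h
    exact h.trans hf
  have := mono_mem_filt (y := y) (s := s) (a := m) (b := 0) hdeg (T := k) (by simpa using hdeg)
  simpa [mono] using this

/-- If every `y j ^ q` can be rewritten with smaller `y`-degree and no larger total degree, then
the exponents of the `y j` can be reduced below `q`. -/
lemma filt_le_span_reduced [DecidableEq ι] {q : ℕ} (hq : 0 < q)
    (hy : ∀ j, y j ^ q ∈ filt y s (q - 1) q) (k T : ℕ) :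
    filt y s k T ≤ Submodule.span ℝ (Set.range
      fun p : (ι → Fin q) × Fin (T + 1) => mono y s (fun j => (p.1 j : ℕ)) p.2) := by
  induction k using Nat.strong_induction_on with
  | _ k ih =>
    refine Submodule.span_le.2 ?_
    rintro _ ⟨a, b, h₁, h₂, rfl⟩
    by_cases h : ∀ j, a j < q
    · exact Submodule.subset_span ⟨⟨fun j => ⟨a j, h j⟩, ⟨b, by omega⟩⟩, rfl⟩
    · push Not at h
      obtain ⟨j, hj⟩ := h
      obtain ⟨a', rfl⟩ : ∃ a' : ι → ℕ, a = a' + Pi.single j q := by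
        refine ⟨a - Pi.single j q, (tsub_add_cancel_of_le fun i => ?_).symm⟩
        by_cases hi : i = j
        · subst hi; simpa using hj
        · simp [hi]
      simp only [Pi.add_apply, Finset.sum_add_distrib, Finset.sum_pi_single', Finset.mem_univ,
        if_true] at h₁ h₂
      have hfac : mono y s (a' + Pi.single j q) b = mono y s a' b * y j ^ q := by
        have h2 : mono y s (Pi.single j q) 0 = y j ^ q := by
          simp [mono, Pi.single_apply, pow_ite, Finset.prod_ite_eq']
        rw [← h2, mono_mul, add_zero]
      refine ih (k - 1) (by omega) ?_
      rw [hfac]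
      refine filt_mono ?_ ?_ (mul_mem_filt (mono_mem_filt le_rfl le_rfl) (hy j))
      · omega
      · omega

/-- A polynomial relation of controlled degree between `s` and an element of bounded degree. -/
lemma exists_relation [DecidableEq ι] {q e : ℕ} (hq : 0 < q)
    (hy : ∀ j, y j ^ q ∈ filt y s (q - 1) q) {F : A} (hF : F ∈ filt y s e e) :
    ∃ c : Fin (e * q ^ Fintype.card ι + 1) ×
        Fin (e * (q ^ Fintype.card ι) ^ 2 + q ^ Fintype.card ι + 1) → ℝ,
      c ≠ 0 ∧ ∑ p, c p • (s ^ (p.1 : ℕ) * F ^ (p.2 : ℕ)) = 0 := by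
  set Q := q ^ Fintype.card ι with hQ
  set α := e * Q with hα
  set β := e * Q ^ 2 + Q with hβ
  set T := α + e * β with hT
  let v : Fin (α + 1) × Fin (β + 1) → A := fun p => s ^ (p.1 : ℕ) * F ^ (p.2 : ℕ)
  let w : (ι → Fin q) × Fin (T + 1) → A := fun p => mono y s (fun j => (p.1 j : ℕ)) p.2
  have hv : ∀ p, v p ∈ Submodule.span ℝ (Set.range w) := by
    intro p
    refine filt_le_span_reduced hq hy (e * β) T ?_
    refine filt_mono ?_ ?_ (mul_mem_filt (pow_mem_filt param_mem_filt p.1) (pow_mem_filt hF p.2))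
    · have := p.2.2
      have : (p.2 : ℕ) ≤ β := by omega
      nlinarith
    · have h1 : (p.2 : ℕ) ≤ β := by have := p.2.2; omega
      have h2 : (p.1 : ℕ) ≤ α := by have := p.1.2; omega
      nlinarith
  have hdep : ¬ LinearIndependent ℝ v := by
    intro hli
    have h1 : Fintype.card (Fin (α + 1) × Fin (β + 1)) ≤
        Module.finrank ℝ (Submodule.span ℝ (Set.range w)) := by
      have hli' : LinearIndependent ℝ
          (fun p => (⟨v p, hv p⟩ : Submodule.span ℝ (Set.range w))) :=
        LinearIndependent.of_comp (Submodule.subtype _) hli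
      have : Module.Finite ℝ (Submodule.span ℝ (Set.range w)) :=
        Module.Finite.span_of_finite ℝ (Set.finite_range w)
      exact hli'.fintype_card_le_finrank
    have h2 : Module.finrank ℝ (Submodule.span ℝ (Set.range w)) ≤ Q * (T + 1) := by
      have := finrank_range_le_card (R := ℝ) w
      simpa [Set.finrank, hQ] using this
    have h3 := h1.trans h2
    simp only [Fintype.card_prod, Fintype.card_fin] at h3
    rw [hT, hβ, hα] at h3
    ring_nf at h3
    have : 0 < Q := by positivity
    nlinarith
  obtain ⟨c, hc, p, hp⟩ := Fintype.not_linearIndependent_iff.1 hdep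
  exact ⟨c, fun h => hp (by simp [h]), hc⟩

lemma pow_mem_filt_of_critical [DecidableEq ι] {d : ℕ} (hd : 1 ≤ d) (j : ι) (a u : ℝ) {e : ℝ}
    (he : e ≠ 0) {P : A} (hP : P ∈ filt y s (2 * d - 1) (2 * d - 1))
    (h : (y j - (algebraMap ℝ A a + s)) * (y j - algebraMap ℝ A u) *
      (algebraMap ℝ A e * y j ^ (2 * d) + P) = 0) :
    y j ^ (2 * d + 2) ∈ filt y s (2 * d + 2 - 1) (2 * d + 2) := by
  have hyj : y j ∈ filt y s 1 1 := coord_mem_filt j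
  have hA : algebraMap ℝ A a + s ∈ filt y s 0 1 :=
    Submodule.add_mem _ (algebraMap_mem_filt _ _ _) param_mem_filt
  have hU : algebraMap ℝ A u ∈ filt y s 0 1 := algebraMap_mem_filt _ _ _
  have hE : algebraMap ℝ A e⁻¹ ∈ filt y s 0 0 := algebraMap_mem_filt _ _ _
  have hEe : algebraMap ℝ A e⁻¹ * algebraMap ℝ A e = 1 := by
    rw [← map_mul, inv_mul_cancel₀ he, map_one]
  generalize algebraMap ℝ A a + s = B at hA h
  generalize algebraMap ℝ A u = U at hU h
  generalize algebraMap ℝ A e⁻¹ = E at hE hEe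
  generalize algebraMap ℝ A e = e' at h hEe
  have key : y j ^ (2 * d + 2) = y j ^ (2 * d) * (y j * (U + B) - B * U) -
      (y j - B) * (y j - U) * (E * P) := by
    rw [pow_add]
    linear_combination E * h - (y j - B) * (y j - U) * y j ^ (2 * d) * hEe
  have hyU : y j * (U + B) ∈ filt y s (1 + 0) (1 + 1) :=
    mul_mem_filt hyj (Submodule.add_mem _ hU hA)
  have hBU : B * U ∈ filt y s (1 + 0) (1 + 1) :=
    mem_filt_of_le (mul_mem_filt hA hU) (by omega) (by omega)
  have hyB : y j - B ∈ filt y s 1 1 := Submodule.sub_mem _ hyj (mem_filt_of_le hA (by omega) le_rfl)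
  have hyU' : y j - U ∈ filt y s 1 1 := Submodule.sub_mem _ hyj (mem_filt_of_le hU (by omega) le_rfl)
  have h2 := mul_mem_filt (mul_mem_filt hyB hyU') (mul_mem_filt hE hP)
  have h3 := mul_mem_filt (pow_mem_filt hyj (2 * d)) (Submodule.sub_mem _ hyU hBU)
  rw [key]
  refine Submodule.sub_mem _ (mem_filt_of_le h3 ?_ ?_) (mem_filt_of_le h2 ?_ ?_) <;> omega

end Filtration

lemma totalDegree_pderiv_le {ι : Type*} (f : MvPolynomial ι ℝ) (j : ι) :
    (MvPolynomial.pderiv j f).totalDegree ≤ f.totalDegree - 1 := by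
  conv_lhs => rw [f.as_sum, map_sum]
  refine MvPolynomial.totalDegree_finsetSum_le fun m hm => ?_
  rw [MvPolynomial.pderiv_monomial]
  by_cases hj : m j = 0
  · simp [hj]
  · refine (MvPolynomial.totalDegree_monomial_le _ _).trans ?_
    have h1 := MvPolynomial.le_totalDegree hm
    have h2 : m = (m - Finsupp.single j 1) + Finsupp.single j 1 := by
      refine (tsub_add_cancel_of_le ?_).symm
      rw [Finsupp.single_le_iff]; omega
    rw [h2, Finsupp.sum_add_index' (by simp) (by simp)] at h1
    simp only [Finsupp.sum_single_index] at h1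
    exact Nat.le_sub_of_add_le h1

lemma hasDerivAt_eval_update {ι : Type*} [DecidableEq ι] (f : MvPolynomial ι ℝ) (x : ι → ℝ)
    (j : ι) (z : ℝ) :
    HasDerivAt (fun z => MvPolynomial.eval (Function.update x j z) f)
      (MvPolynomial.eval (Function.update x j z) (MvPolynomial.pderiv j f)) z := by
  induction f using MvPolynomial.induction_on with
  | C r => simpa using hasDerivAt_const z r
  | add p q hp hq =>
    simp only [map_add]
    exact hp.add hq
  | mul_X p i hp =>
    have hX : HasDerivAt (fun z => Function.update x j z i) (if i = j then 1 else 0) z := by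
      by_cases h : i = j
      · subst h; simpa using! hasDerivAt_id z
      · simpa [h] using hasDerivAt_const z (x i)
    have := hp.mul hX
    rw [Derivation.leibniz]
    convert! this using 1
    · ext; simp
    · by_cases h : i = j
      · subst h; simp [mul_comm, add_comm]
      · simp [h]
        ring

lemma hasDerivAt_min_zero_sq (y : ℝ) : HasDerivAt (fun y => (min y 0) ^ 2) (2 * min y 0) y := by
  rcases lt_trichotomy y 0 with h | rfl | h
  · have h1 : (fun y : ℝ => y ^ 2) =ᶠ[nhds y] fun y => (min y 0) ^ 2 := by
      filter_upwards [gt_mem_nhds h] with z hz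
      rw [min_eq_left hz.le]
    rw [min_eq_left h.le]
    simpa using (hasDerivAt_pow 2 y).congr_of_eventuallyEq h1.symm
  · rw [hasDerivAt_iff_isLittleO]
    simp only [min_self, mul_zero, smul_zero, sub_zero, ne_eq, OfNat.ofNat_ne_zero,
      not_false_eq_true, zero_pow]
    have h1 : (fun y : ℝ => (min y 0) ^ 2) =O[nhds 0] fun y : ℝ => y ^ 2 := by
      refine Asymptotics.isBigO_of_le _ fun y => ?_
      simp only [norm_pow, Real.norm_eq_abs]
      refine pow_le_pow_left₀ (abs_nonneg _) ?_ 2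
      rcases le_total y 0 with h | h <;> simp [h]
    refine h1.trans_isLittleO ?_
    simpa using Asymptotics.isLittleO_pow_pow (𝕜 := ℝ) (one_lt_two)
  · have h1 : (fun y : ℝ => (0 : ℝ)) =ᶠ[nhds y] fun y => (min y 0) ^ 2 := by
      filter_upwards [lt_mem_nhds h] with z hz
      simp [min_eq_right hz.le]
    rw [min_eq_right h.le]
    simpa using (hasDerivAt_const y (0 : ℝ)).congr_of_eventuallyEq h1.symm

open Polynomial in
lemma exists_pow_le_abs_eval {p : ℝ[X]} (hp : p ≠ 0) {n : ℕ} (hn : p.natDegree ≤ n) :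
    ∃ c > 0, ∃ s₀ > 0, ∀ s, 0 < s → s < s₀ → c * s ^ n ≤ |p.eval s| := by
  obtain ⟨g, hg, hdvd⟩ := p.exists_eq_pow_rootMultiplicity_mul_and_not_dvd hp 0
  rw [C_0, sub_zero] at hg hdvd
  set m := p.rootMultiplicity 0
  have hm : m ≤ n := by
    have h := natDegree_le_of_dvd (Dvd.intro _ hg.symm) hp
    rw [natDegree_X_pow] at h
    exact h.trans hn
  have hg0 : g.eval 0 ≠ 0 := by
    rwa [← coeff_zero_eq_eval_zero, ne_eq, ← X_dvd_iff]
  have hcont : Filter.Tendsto (fun s => |g.eval s|) (nhds 0) (nhds |g.eval 0|) :=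
    (g.continuous.abs).tendsto 0
  have hlt : |g.eval 0| / 2 < |g.eval 0| := half_lt_self (abs_pos.2 hg0)
  obtain ⟨δ, hδ, h⟩ := Metric.eventually_nhds_iff.1 (hcont.eventually (lt_mem_nhds hlt))
  refine ⟨|g.eval 0| / 2, half_pos (abs_pos.2 hg0), min δ 1, by positivity, fun s hs hs' => ?_⟩
  have h1 : |g.eval 0| / 2 < |g.eval s| :=
    h (by rw [Real.dist_eq, sub_zero, abs_of_pos hs]; exact hs'.trans_le (min_le_left _ _))
  have h2 : s ^ n ≤ s ^ m :=
    pow_le_pow_of_le_one hs.le (hs'.le.trans (min_le_right _ _)) hm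
  rw [hg, eval_mul, eval_pow, eval_X, abs_mul, abs_pow, abs_of_pos hs, mul_comm]
  gcongr

open Polynomial in
/-- A positive root `v` of a nonzero polynomial relation `∑ p b (s) v ^ b = 0` is at least of
order `s ^ n`, where `n` bounds the degrees in `s`. -/
lemma pow_le_of_relation {n : ℕ} (N : ℕ) (p : ℕ → ℝ[X]) (hn : ∀ b, (p b).natDegree ≤ n)
    (hp : ∃ b < N, p b ≠ 0) :
    ∃ c > 0, ∃ s₀ > 0, ∀ s, 0 < s → s < s₀ → ∀ v, 0 < v →
      ∑ b ∈ Finset.range N, (p b).eval s * v ^ b = 0 → c * s ^ n ≤ v := by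
  induction N generalizing p with
  | zero => obtain ⟨b, hb, -⟩ := hp; omega
  | succ N ih =>
    by_cases h0 : p 0 = 0
    · obtain ⟨c, hc, s₀, hs₀, h⟩ := ih (fun b => p (b + 1)) (fun b => hn _) (by
        obtain ⟨b, hb, hb'⟩ := hp
        cases b with
        | zero => exact absurd h0 hb'
        | succ b => exact ⟨b, by omega, hb'⟩)
      refine ⟨c, hc, s₀, hs₀, fun s hs hs' v hv hsum => h s hs hs' v hv ?_⟩
      rw [Finset.sum_range_succ', h0] at hsum
      simp only [eval_zero, zero_mul, add_zero, pow_succ, ← mul_assoc, ← Finset.sum_mul] at hsum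
      exact (mul_eq_zero.1 hsum).resolve_right hv.ne'
    · obtain ⟨c, hc, s₀, hs₀, h⟩ := exists_pow_le_abs_eval h0 (hn 0)
      have hbd : ∀ q : ℝ[X], ∃ C, ∀ s ∈ Set.Icc (0 : ℝ) 1, |q.eval s| ≤ C := fun q =>
        (isCompact_Icc.exists_bound_of_continuousOn q.continuous.continuousOn)
      choose C hC using fun b => hbd (p b)
      have hC0 : ∀ b, 0 ≤ C b := fun b => (abs_nonneg _).trans (hC b 0 (by simp))
      set B := 1 + ∑ b ∈ Finset.range N, C (b + 1) with hB
      have hBpos : 0 < B := add_pos_of_pos_of_nonneg one_pos (Finset.sum_nonneg fun b _ => hC0 _)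
      refine ⟨min 1 (c / B), by positivity, min s₀ 1, by positivity, fun s hs hs' v hv hsum => ?_⟩
      have hs1 : s ≤ 1 := hs'.le.trans (min_le_right _ _)
      rcases le_total 1 v with hv1 | hv1
      · calc min 1 (c / B) * s ^ n ≤ 1 * 1 := by
              gcongr
              · exact min_le_left _ _
              · exact pow_le_one₀ hs.le hs1
          _ ≤ v := by simpa using hv1
      · rw [Finset.sum_range_succ'] at hsum
        have h1 : |(p 0).eval s| ≤ B * v := by
          have : (p 0).eval s = -∑ b ∈ Finset.range N, (p (b + 1)).eval s * v ^ (b + 1) := by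
            simp only [pow_zero, mul_one] at hsum; linarith
          rw [this, abs_neg]
          refine (Finset.abs_sum_le_sum_abs _ _).trans ?_
          have : ∑ b ∈ Finset.range N, |(p (b + 1)).eval s * v ^ (b + 1)| ≤
              ∑ b ∈ Finset.range N, C (b + 1) * v := by
            refine Finset.sum_le_sum fun b _ => ?_
            rw [abs_mul, abs_of_pos (pow_pos hv _)]
            refine mul_le_mul (hC _ s ⟨hs.le, hs1⟩) ?_ (by positivity) (hC0 _)
            exact pow_le_of_le_one hv.le hv1 (by omega)
          refine this.trans ?_
          rw [← Finset.sum_mul, hB]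
          gcongr; linarith
        have h2 := h s hs (hs'.trans_le (min_le_left _ _))
        calc min 1 (c / B) * s ^ n ≤ c / B * s ^ n := by gcongr; exact min_le_right _ _
          _ = (c * s ^ n) / B := by ring
          _ ≤ (B * v) / B := div_le_div_of_nonneg_right (h2.trans h1) hBpos.le
          _ = v := by field_simp
lemma exists_pos_forall_le {ι : Type*} [Finite ι] {k : ι → ℝ} (hk : ∀ i, 0 < k i) :
    ∃ c > 0, ∀ i, c ≤ k i := by
  rcases isEmpty_or_nonempty ι with h | h
  · exact ⟨1, one_pos, fun i => h.elim i⟩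
  · obtain ⟨i, hi⟩ := Finite.exists_min k
    exact ⟨k i, hk i, hi⟩


section Lojasiewicz

variable {ι I : Type*} [Fintype ι] [DecidableEq ι] [Fintype I]

/-- The points satisfying the perturbed first-order conditions for minimizing `H` over the box
`∏ j, [a j + s, u j]`. -/
def critSet (a u : ι → ℝ) (e : ℝ) (r : ℕ) (H : MvPolynomial ι ℝ) : Set ((ι → ℝ) × ℝ) :=
  {z | ∀ j, (z.1 j - (a j + z.2)) * (z.1 j - u j) *
    (e * z.1 j ^ r + MvPolynomial.eval z.1 (MvPolynomial.pderiv j H)) = 0}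

omit [Fintype ι] [DecidableEq ι] in
lemma aeval_fun_apply {Z : Type*} (y : ι → Z → ℝ) (f : MvPolynomial ι ℝ) (z : Z) :
    MvPolynomial.aeval y f z = MvPolynomial.eval (fun j => y j z) f := by
  have : (Pi.evalAlgHom ℝ (fun _ : Z => ℝ) z).comp (MvPolynomial.aeval y) =
      MvPolynomial.aeval (fun j => y j z) := by
    ext j; simp
  have h := DFunLike.congr_fun this f
  simpa [MvPolynomial.coe_aeval_eq_eval] using h

lemma exists_relation_critSet (a u : ι → ℝ) {e : ℝ} (he : e ≠ 0) {d : ℕ} (hd : 1 ≤ d)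
    {H : MvPolynomial ι ℝ} (hH : H.totalDegree ≤ 2 * d) :
    ∃ c : Fin (2 * d * (2 * d + 2) ^ Fintype.card ι + 1) ×
        Fin (2 * d * ((2 * d + 2) ^ Fintype.card ι) ^ 2 + (2 * d + 2) ^ Fintype.card ι + 1) → ℝ,
      ‖c‖ = 1 ∧ ∀ z ∈ critSet a u e (2 * d) H,
        ∑ p, c p * (z.2 ^ (p.1 : ℕ) * MvPolynomial.eval z.1 H ^ (p.2 : ℕ)) = 0 := by
  let Z := critSet a u e (2 * d) H
  let y : ι → Z → ℝ := fun j z => z.1.1 j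
  let s : Z → ℝ := fun z => z.1.2
  have hy : ∀ j, y j ^ (2 * d + 2) ∈ filt y s (2 * d + 2 - 1) (2 * d + 2) := fun j => by
    refine pow_mem_filt_of_critical hd j (a j) (u j) he (aeval_mem_filt
      (f := MvPolynomial.pderiv j H) ((totalDegree_pderiv_le H j).trans (by omega))) ?_
    funext z
    simpa [aeval_fun_apply] using z.2 j
  obtain ⟨c, hc, hsum⟩ := exists_relation (by omega) hy (aeval_mem_filt (s := s) hH)
  refine ⟨‖c‖⁻¹ • c, norm_smul_inv_norm hc, fun z hz => ?_⟩
  have h := congrFun hsum ⟨z, hz⟩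
  simp only [Finset.sum_apply, Pi.smul_apply, Pi.mul_apply, Pi.pow_apply, Pi.zero_apply,
    aeval_fun_apply, smul_eq_mul] at h
  simp only [Pi.smul_apply, smul_eq_mul, mul_assoc, ← Finset.mul_sum]
  rw [h, mul_zero]

/-- The total squared violation of the inequalities `f i ≥ 0` at `x`. -/
noncomputable def violation (f : I → MvPolynomial ι ℝ) (x : ι → ℝ) : ℝ :=
  ∑ i, (min (MvPolynomial.eval x (f i)) 0) ^ 2

omit [Fintype ι] [DecidableEq ι] in
lemma continuous_violation (f : I → MvPolynomial ι ℝ) : Continuous (violation f) := by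
  unfold violation
  exact continuous_finsetSum _ fun i _ =>
    ((MvPolynomial.continuous_eval (f i)).min continuous_const).pow 2

lemma exists_perturbed_minimizer (f : I → MvPolynomial ι ℝ) (a u : ι → ℝ) (s e : ℝ) (r : ℕ)
    (h : ∀ j, a j + s ≤ u j) :
    ∃ x, (∀ j, a j + s ≤ x j) ∧ (∀ j, x j ≤ u j) ∧
      (∀ z : ι → ℝ, (∀ j, a j + s ≤ z j) → (∀ j, z j ≤ u j) →
        violation f x + e * ∑ j, x j ^ (r + 1) ≤ violation f z + e * ∑ j, z j ^ (r + 1)) ∧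
      ∃ A : Finset I, violation f x = MvPolynomial.eval x (∑ i ∈ A, f i ^ 2) ∧
        (x, s) ∈ critSet a u (e * (r + 1)) r (∑ i ∈ A, f i ^ 2) := by
  classical
  let l : ι → ℝ := fun j => a j + s
  let Ψ : (ι → ℝ) → ℝ := fun x => violation f x + e * ∑ j, x j ^ (r + 1)
  have hΨ : Continuous Ψ := (continuous_violation f).add (by fun_prop)
  obtain ⟨x, hx, hmin⟩ := (isCompact_Icc (a := l) (b := u)).exists_isMinOn
    ⟨l, le_rfl, h⟩ hΨ.continuousOn
  refine ⟨x, hx.1, hx.2, fun z hz hz' => hmin ⟨hz, hz'⟩,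
    Finset.univ.filter fun i => MvPolynomial.eval x (f i) < 0, ?_, fun j => ?_⟩
  · rw [map_sum, violation, Finset.sum_filter]
    refine Finset.sum_congr rfl fun i _ => ?_
    split_ifs with hi
    · rw [min_eq_left hi.le, map_pow]
    · rw [min_eq_right (not_lt.1 hi)]; simp
  · rcases (hx.1 j).eq_or_lt with hj | hj
    · simp [← hj, l]
    rcases (hx.2 j).eq_or_lt with hj' | hj'
    · simp [hj']
    have hloc : IsLocalMin (fun z => Ψ (Function.update x j z)) (x j) := by
      filter_upwards [Ioo_mem_nhds hj hj'] with z hz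
      rw [Function.update_eq_self]
      refine hmin ⟨?_, ?_⟩
      · exact le_update_iff.2 ⟨hz.1.le, fun k _ => hx.1 k⟩
      · exact update_le_iff.2 ⟨hz.2.le, fun k _ => hx.2 k⟩
    have hder : HasDerivAt (fun z => Ψ (Function.update x j z))
        ((∑ i, 2 * min (MvPolynomial.eval x (f i)) 0 *
          MvPolynomial.eval x (MvPolynomial.pderiv j (f i))) + e * ((r + 1) * x j ^ r)) (x j) := by
      refine HasDerivAt.add (HasDerivAt.fun_sum fun i _ => ?_) (HasDerivAt.const_mul e ?_)
      · have h1 := hasDerivAt_eval_update (f i) x j (x j)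
        have h2 := (hasDerivAt_min_zero_sq
          (MvPolynomial.eval (Function.update x j (x j)) (f i))).comp (x j) h1
        simpa only [Function.update_eq_self] using! h2
      · have h1 : HasDerivAt (fun z => ∑ k, Function.update x j z k ^ (r + 1))
            (∑ k, if k = j then ((r : ℝ) + 1) * x j ^ r else 0) (x j) := by
          refine HasDerivAt.fun_sum fun k _ => ?_
          split_ifs with hk
          · subst hk; simpa using hasDerivAt_pow (r + 1) (x k)
          · simpa [hk] using hasDerivAt_const (x j) (x k ^ (r + 1))
        simpa using h1
    have h0 := hloc.hasDerivAt_eq_zero hder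
    have h1 : MvPolynomial.eval x (MvPolynomial.pderiv j
        (∑ i with MvPolynomial.eval x (f i) < 0, f i ^ 2)) =
        ∑ i, 2 * min (MvPolynomial.eval x (f i)) 0 *
          MvPolynomial.eval x (MvPolynomial.pderiv j (f i)) := by
      rw [map_sum, map_sum, Finset.sum_filter]
      refine Finset.sum_congr rfl fun i _ => ?_
      split_ifs with hi
      · rw [min_eq_left hi.le, Derivation.leibniz_pow]
        simp [mul_assoc]
      · rw [min_eq_right (not_lt.1 hi)]; simp
    simp only
    rw [h1]
    have : e * (r + 1) * x j ^ r + ∑ i, 2 * min (MvPolynomial.eval x (f i)) 0 *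
        MvPolynomial.eval x (MvPolynomial.pderiv j (f i)) = 0 := by linarith
    rw [this, mul_zero]


open Polynomial in
lemma pow_le_of_fin_relation {m n : ℕ} {c : Fin (m + 1) × Fin (n + 1) → ℝ} (hc : c ≠ 0) :
    ∃ k > 0, ∃ s₀ > 0, ∀ s, 0 < s → s < s₀ → ∀ v, 0 < v →
      ∑ p, c p * (s ^ (p.1 : ℕ) * v ^ (p.2 : ℕ)) = 0 → k * s ^ m ≤ v := by
  let P : ℕ → ℝ[X] := fun b =>
    if h : b < n + 1 then ∑ i : Fin (m + 1), C (c (i, ⟨b, h⟩)) * X ^ (i : ℕ) else 0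
  have hP : ∀ b : Fin (n + 1), P b = ∑ i : Fin (m + 1), C (c (i, b)) * X ^ (i : ℕ) := fun b => by
    simp only [P, b.2, dif_pos]
  have hdeg : ∀ b, (P b).natDegree ≤ m := fun b => by
    by_cases h : b < n + 1
    · simp only [P, h, dif_pos]
      refine natDegree_sum_le_of_forall_le _ _ fun i _ => ?_
      exact (natDegree_C_mul_X_pow_le _ _).trans (Nat.lt_succ_iff.1 i.2)
    · simp only [P, h, not_false_eq_true, dif_neg, natDegree_zero, Nat.zero_le]
  have hne : ∃ b < n + 1, P b ≠ 0 := by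
    obtain ⟨⟨i, b⟩, hib⟩ := Function.ne_iff.1 hc
    refine ⟨b, b.2, fun h => hib ?_⟩
    have h1 := congrArg (fun q => q.coeff (i : ℕ)) h
    simpa [hP, finsetSum_coeff, coeff_X_pow, Fin.val_inj] using h1
  obtain ⟨k, hk, s₀, hs₀, h⟩ := pow_le_of_relation (n + 1) P hdeg hne
  refine ⟨k, hk, s₀, hs₀, fun s hs hs' v hv hsum => h s hs hs' v hv ?_⟩
  rw [Finset.sum_range, ← hsum, Fintype.sum_prod_type_right]
  refine Finset.sum_congr rfl fun b _ => ?_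
  rw [hP, eval_finsetSum, Finset.sum_mul]
  refine Finset.sum_congr rfl fun i _ => ?_
  simp [mul_assoc]

/-- If critical points satisfy polynomial relations of bounded degrees, then the minimal violation
over the box `∏ j, [a j + s, u j]` satisfies one of finitely many nontrivial relations with `s` of
the same degrees. -/
lemma exists_relation_min_violation (f : I → MvPolynomial ι ℝ) (a u : ι → ℝ) (ha : ∀ j, 0 ≤ a j)
    {m n r : ℕ} (hrel : ∀ e : ℝ, e ≠ 0 → ∀ A : Finset I, ∃ c : Fin (m + 1) × Fin (n + 1) → ℝ,
      ‖c‖ = 1 ∧ ∀ z ∈ critSet a u e r (∑ i ∈ A, f i ^ 2), ∑ p, c p * (z.2 ^ (p.1 : ℕ) *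
        MvPolynomial.eval z.1 (∑ i ∈ A, f i ^ 2) ^ (p.2 : ℕ)) = 0) :
    ∃ c : Finset I → Fin (m + 1) × Fin (n + 1) → ℝ,
      (∀ A, ‖c A‖ = 1) ∧ ∀ s, 0 ≤ s → (∀ j, a j + s ≤ u j) →
        ∃ x : ι → ℝ, (∀ j, a j + s ≤ x j) ∧ (∀ j, x j ≤ u j) ∧
          (∀ z : ι → ℝ, (∀ j, a j + s ≤ z j) → (∀ j, z j ≤ u j) →
            violation f x ≤ violation f z) ∧
          ∃ A, ∑ p, c A p * (s ^ (p.1 : ℕ) * violation f x ^ (p.2 : ℕ)) = 0 := by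
  let e : ℕ → ℝ := fun k => 1 / ((k : ℝ) + 1)
  have he : ∀ k, 0 < e k := fun k => by positivity
  have hr : (0 : ℝ) < r + 1 := by positivity
  choose c₀ hc₀ hrel using fun (k : ℕ) (A : Finset I) => hrel _ (mul_pos (he k) hr).ne' A
  have hcomp := isCompact_univ_pi fun _ : Finset I =>
    isCompact_sphere (0 : Fin (m + 1) × Fin (n + 1) → ℝ) 1
  obtain ⟨c, hc, φ, hφ, hlim⟩ := hcomp.tendsto_subseq (x := c₀) fun k A _ => by
    simpa using hc₀ k A
  refine ⟨c, fun A => by simpa using hc A (Set.mem_univ A), fun s hs hbox => ?_⟩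
  obtain ⟨x, hx, hx', hmin, -⟩ := exists_perturbed_minimizer f a u s 0 0 hbox
  simp only [zero_mul, add_zero] at hmin
  refine ⟨x, hx, hx', hmin, ?_⟩
  choose z hz hz' hzmin hzA using fun k =>
    exists_perturbed_minimizer f a u s (e k) r hbox
  have hv : Filter.Tendsto (fun k => violation f (z k)) Filter.atTop (nhds (violation f x)) := by
    have hup : Filter.Tendsto (fun k => violation f x + e k * ∑ j, x j ^ (r + 1))
        Filter.atTop (nhds (violation f x)) := by
      simpa [e] using (tendsto_one_div_add_atTop_nhds_zero_nat (𝕜 := ℝ)).mul_const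
        (∑ j, x j ^ (r + 1)) |>.const_add (violation f x)
    refine tendsto_of_tendsto_of_tendsto_of_le_of_le tendsto_const_nhds hup
      (fun k => hmin _ (hz k) (hz' k)) (fun k => ?_)
    have h1 := hzmin k x hx hx'
    have h2 : 0 ≤ e k * ∑ j, z k j ^ (r + 1) :=
      mul_nonneg (he k).le (Finset.sum_nonneg fun j _ =>
        pow_nonneg ((add_nonneg (ha j) hs).trans (hz k j)) _)
    simp only
    linarith
  let R : (Finset I → Fin (m + 1) × Fin (n + 1) → ℝ) → ℝ → ℝ := fun c v =>
    ∏ A, ∑ p, c A p * (s ^ (p.1 : ℕ) * v ^ (p.2 : ℕ))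
  have hR : Continuous (Function.uncurry R) := by
    simp only [R, Function.uncurry_def]
    fun_prop
  have hR0 : ∀ k, R (c₀ k) (violation f (z k)) = 0 := fun k => by
    obtain ⟨A, hA, hcrit⟩ := hzA k
    refine Finset.prod_eq_zero (Finset.mem_univ A) ?_
    rw [hA]
    exact hrel k A _ hcrit
  have hRlim := (hR.tendsto (c, violation f x)).comp (hlim.prodMk_nhds (hv.comp hφ.tendsto_atTop))
  have h0 : R c (violation f x) = 0 :=
    tendsto_nhds_unique (hRlim.congr fun k => hR0 (φ k)) tendsto_const_nhds
  obtain ⟨A, -, hA⟩ := Finset.prod_eq_zero_iff.1 h0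
  exact ⟨A, hA⟩

/-- An effective Łojasiewicz inequality for an infeasible system of polynomial inequalities. -/
theorem pow_le_violation {d : ℕ} (hd : 1 ≤ d) (f : I → MvPolynomial ι ℝ)
    (hf : ∀ i, (f i).totalDegree ≤ d) (a u : ι → ℝ) (ha : ∀ j, 0 ≤ a j)
    (hinf : ∀ x : ι → ℝ, (∀ j, a j < x j) → (∀ j, x j ≤ u j) →
      ∃ i, MvPolynomial.eval x (f i) < 0) :
    ∃ c > 0, ∃ s₀ > 0, ∀ s, 0 < s → s < s₀ → ∀ x : ι → ℝ, (∀ j, a j + s ≤ x j) →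
      (∀ j, x j ≤ u j) → c * s ^ (2 * d * (2 * d + 2) ^ Fintype.card ι) ≤ violation f x := by
  have hdeg : ∀ A : Finset I, (∑ i ∈ A, f i ^ 2).totalDegree ≤ 2 * d := fun A =>
    MvPolynomial.totalDegree_finsetSum_le fun i _ =>
      (MvPolynomial.totalDegree_pow _ _).trans (Nat.mul_le_mul_left 2 (hf i))
  obtain ⟨c, hc, h⟩ := exists_relation_min_violation f a u ha fun e he A =>
    exists_relation_critSet a u he hd (hdeg A)
  choose k hk s₀ hs₀ hbd using fun A : Finset I =>
    pow_le_of_fin_relation (c := c A) (fun h0 => by simpa [h0] using hc A)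
  have hne : (Finset.univ : Finset (Finset I)).Nonempty := ⟨∅, Finset.mem_univ _⟩
  refine ⟨Finset.univ.inf' hne k, (Finset.lt_inf'_iff hne).2 fun A _ => hk A,
    Finset.univ.inf' hne s₀, (Finset.lt_inf'_iff hne).2 fun A _ => hs₀ A,
    fun s hs hs' z hz hz' => ?_⟩
  obtain ⟨x, hx, hx', hmin, A, hA⟩ := h s hs.le fun j => (hz j).trans (hz' j)
  have hpos : 0 < violation f x := by
    obtain ⟨i, hi⟩ := hinf x (fun j => by linarith [hx j]) hx'
    refine Finset.sum_pos' (fun i _ => sq_nonneg _) ⟨i, Finset.mem_univ i, ?_⟩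
    rw [min_eq_left hi.le]
    exact sq_pos_of_neg hi
  have h1 := hbd A s hs ((Finset.lt_inf'_iff hne).1 hs' A (Finset.mem_univ A)) _ hpos hA
  calc Finset.univ.inf' hne k * s ^ (2 * d * (2 * d + 2) ^ Fintype.card ι)
      ≤ k A * s ^ (2 * d * (2 * d + 2) ^ Fintype.card ι) := by
        gcongr; exact Finset.inf'_le _ (Finset.mem_univ A)
    _ ≤ violation f x := h1
    _ ≤ violation f z := hmin z hz hz'

end Lojasiewicz

section PolynomialGerms

open Polynomial Filter Topology

lemma eventually_pow_le_eval {f : ℝ[X]} {l : ℕ} (hf : polyPos f)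
    (hl : f.trailingDegree ≤ (l : ℕ∞)) : ∃ c > 0, ∀ᶠ t in 𝓝[>] (0 : ℝ), c * t ^ l ≤ f.eval t := by
  have hf0 : f ≠ 0 := by rintro rfl; simp [polyPos] at hf
  have hkl : f.natTrailingDegree ≤ l := by
    rw [trailingDegree_eq_natTrailingDegree hf0] at hl
    exact_mod_cast hl
  obtain ⟨g, hg⟩ : X ^ f.natTrailingDegree ∣ f :=
    X_pow_dvd_iff.2 fun d hd => coeff_eq_zero_of_lt_natTrailingDegree hd
  have hg0 : 0 < g.eval 0 := by
    have h1 : f.trailingCoeff = g.coeff 0 := by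
      have h := coeff_X_pow_mul g f.natTrailingDegree 0
      rw [← hg, zero_add] at h
      exact h
    rw [← coeff_zero_eq_eval_zero, ← h1]
    exact hf
  refine ⟨g.eval 0 / 2, half_pos hg0, ?_⟩
  have h2 : ∀ᶠ t in 𝓝[>] (0 : ℝ), g.eval 0 / 2 < g.eval t :=
    nhdsWithin_le_nhds (g.continuous.tendsto 0 |>.eventually (lt_mem_nhds (half_lt_self hg0)))
  filter_upwards [h2, Ioo_mem_nhdsGT one_pos] with t ht ht'
  rw [hg, eval_mul, eval_pow, eval_X, mul_comm]
  have h3 : t ^ l ≤ t ^ f.natTrailingDegree := pow_le_pow_of_le_one ht'.1.le ht'.2.le hkl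
  have h4 : 0 < t := ht'.1
  gcongr

lemma eventually_min_sq_le {f : ℝ[X]} {r : ℕ}
    (hf : polyNonneg f ∨ ((r : ℕ) : ℕ∞) ≤ f.trailingDegree) :
    ∃ C ≥ 0, ∀ᶠ t in 𝓝[>] (0 : ℝ), (min (f.eval t) 0) ^ 2 ≤ C * (t ^ r) ^ 2 := by
  have hnonneg : (∀ᶠ t in 𝓝[>] (0 : ℝ), 0 ≤ f.eval t) →
      ∃ C ≥ 0, ∀ᶠ t in 𝓝[>] (0 : ℝ), (min (f.eval t) 0) ^ 2 ≤ C * (t ^ r) ^ 2 := fun h =>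
    ⟨0, le_rfl, h.mono fun t ht => by simp [min_eq_right ht]⟩
  rcases hf with (rfl | hf) | hf
  · exact hnonneg (by simp)
  · obtain ⟨c, hc, h⟩ := eventually_pow_le_eval (l := f.natTrailingDegree) hf
      (le_of_eq (trailingDegree_eq_natTrailingDegree (by rintro rfl; simp at hf)))
    refine hnonneg ?_
    filter_upwards [h, self_mem_nhdsWithin] with t ht ht'
    have : (0 : ℝ) < t := ht'
    exact le_trans (by positivity) ht
  · obtain ⟨g, hg⟩ : X ^ r ∣ f := X_pow_dvd_iff.2 fun d hd =>
      coeff_eq_zero_of_lt_trailingDegree (lt_of_lt_of_le (by exact_mod_cast hd) hf)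
    refine ⟨(|g.eval 0| + 1) ^ 2, by positivity, ?_⟩
    have h2 : ∀ᶠ t in 𝓝[>] (0 : ℝ), |g.eval t| < |g.eval 0| + 1 :=
      nhdsWithin_le_nhds (g.continuous.abs.tendsto 0 |>.eventually (gt_mem_nhds (lt_add_one _)))
    filter_upwards [h2] with t ht
    have h3 : (min (f.eval t) 0) ^ 2 ≤ (f.eval t) ^ 2 := by
      rcases le_total (f.eval t) 0 with h | h
      · rw [min_eq_left h]
      · simpa [min_eq_right h] using sq_nonneg (f.eval t)
    refine h3.trans ?_
    rw [hg, eval_mul, eval_pow, eval_X, mul_pow, mul_comm]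
    refine mul_le_mul_of_nonneg_right ?_ (sq_nonneg _)
    exact sq_le_sq' (by linarith [neg_abs_le (g.eval t)]) (by linarith [le_abs_self (g.eval t)])

end PolynomialGerms

section Game

open Filter Topology

variable {S : Fin N → Type} [∀ n, Fintype (S n)]

lemma payoff_update (G : Fin N → (∀ m, S m) → ℝ) (n : Fin N) (τ : S n → ℝ)
    (x : Profile S) :
    payoff G n (Function.update x n τ) =
      ∑ s : ∀ m, S m, τ (s n) * G n s * ∏ m ∈ Finset.univ.erase n, x m (s m) := by
  refine Finset.sum_congr rfl fun s _ => ?_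
  rw [← Finset.mul_prod_erase _ _ (Finset.mem_univ n), Function.update_self]
  have : ∏ m ∈ Finset.univ.erase n, Function.update x n τ m (s m) =
      ∏ m ∈ Finset.univ.erase n, x m (s m) :=
    Finset.prod_congr rfl fun m hm => by rw [Function.update_of_ne (Finset.ne_of_mem_erase hm)]
  rw [this]
  ring

variable [∀ n, DecidableEq (S n)]

/-- The payoff advantage for player `n` of `τ` over the pure strategy `sn`, as a polynomial in the
profile. -/
noncomputable def advantagePoly (G : Fin N → (∀ m, S m) → ℝ) (n : Fin N) (τ : S n → ℝ) (sn : S n) :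
    MvPolynomial (Σ n, S n) ℝ :=
  ∑ s : ∀ m, S m, MvPolynomial.C ((τ (s n) - pureStrat sn (s n)) * G n s) *
    ∏ m ∈ Finset.univ.erase n, MvPolynomial.X ⟨m, s m⟩

variable (G : Fin N → (∀ m, S m) → ℝ) (n : Fin N) (τ : S n → ℝ) (sn : S n)

lemma totalDegree_advantagePoly_le : (advantagePoly G n τ sn).totalDegree ≤ N - 1 := by
  refine MvPolynomial.totalDegree_finsetSum_le fun s _ => ?_
  refine (MvPolynomial.totalDegree_mul _ _).trans ?_
  rw [MvPolynomial.totalDegree_C, zero_add]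
  refine (MvPolynomial.totalDegree_finsetProd _ _).trans ?_
  simp

lemma eval_advantagePoly (x : (Σ n, S n) → ℝ) :
    MvPolynomial.eval x (advantagePoly G n τ sn) =
      ∑ s : ∀ m, S m, (τ (s n) - pureStrat sn (s n)) * G n s *
        ∏ m ∈ Finset.univ.erase n, x ⟨m, s m⟩ := by
  simp [advantagePoly]

lemma payoff_update_sub (x : Profile S) :
    payoff G n (Function.update x n τ) - payoff G n (Function.update x n (pureStrat sn)) =
      MvPolynomial.eval (fun p => x p.1 p.2) (advantagePoly G n τ sn) := by
  rw [payoff_update, payoff_update, eval_advantagePoly, ← Finset.sum_sub_distrib]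
  exact Finset.sum_congr rfl fun s _ => by ring

lemma eval_payoffPoly_sub (η : PolyProfile S) (t : ℝ) :
    (payoffPoly G η n τ - payoffPoly G η n (pureStrat sn)).eval t =
      MvPolynomial.eval (fun p => (η p.1 p.2).eval t) (advantagePoly G n τ sn) := by
  rw [eval_advantagePoly, Polynomial.eval_sub, payoffPoly, payoffPoly, Polynomial.eval_finsetSum,
    Polynomial.eval_finsetSum, ← Finset.sum_sub_distrib]
  refine Finset.sum_congr rfl fun s _ => ?_
  simp only [Polynomial.eval_mul, Polynomial.eval_C, Polynomial.eval_prod]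
  ring

lemma eval_advantagePoly_scale (x : (Σ n, S n) → ℝ) (c : Fin N → ℝ) :
    MvPolynomial.eval (fun p => c p.1 * x p) (advantagePoly G n τ sn) =
      (∏ m ∈ Finset.univ.erase n, c m) * MvPolynomial.eval x (advantagePoly G n τ sn) := by
  rw [eval_advantagePoly, eval_advantagePoly, Finset.mul_sum]
  refine Finset.sum_congr rfl fun s _ => ?_
  rw [Finset.prod_mul_distrib]
  ring

omit sn τ n in
/-- Positive vectors near `σ` against which `σ` is optimal can be normalized to mixed profiles. -/
lemma isPerfect_of_forall_exists [∀ n, Nonempty (S n)] {σ : Profile S} (hσ : IsMixed σ)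
    (h : ∀ δ > 0, ∃ x : (Σ n, S n) → ℝ, (∀ p, 0 < x p) ∧ (∀ p, |x p - σ p.1 p.2| ≤ δ) ∧
      ∀ n sn, 0 ≤ MvPolynomial.eval x (advantagePoly G n (σ n) sn)) :
    IsPerfect G σ := by
  choose x hx hdist hadv using fun k : ℕ => h (1 / ((k : ℝ) + 1)) (by positivity)
  have hlim : ∀ n s, Tendsto (fun k => x k ⟨n, s⟩) atTop (𝓝 (σ n s)) := fun n s => by
    rw [tendsto_iff_dist_tendsto_zero]
    exact squeeze_zero (fun _ => dist_nonneg) (fun k => hdist k ⟨n, s⟩)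
      tendsto_one_div_add_atTop_nhds_zero_nat
  let w : ℕ → Fin N → ℝ := fun k n => ∑ s, x k ⟨n, s⟩
  have hw : ∀ k n, 0 < w k n := fun k n =>
    Finset.sum_pos (fun s _ => hx k _) Finset.univ_nonempty
  have hwlim : ∀ n, Tendsto (fun k => w k n) atTop (𝓝 1) := fun n => by
    rw [← (hσ n).2]
    exact tendsto_finsetSum _ fun s _ => hlim n s
  refine ⟨fun k n s => (w k n)⁻¹ * x k ⟨n, s⟩, fun k => ⟨fun n => ⟨fun s => ?_, ?_⟩, fun n s => ?_⟩,
    ?_, fun k n sn => ?_⟩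
  · exact (mul_pos (inv_pos.2 (hw k n)) (hx k _)).le
  · rw [← Finset.mul_sum]
    exact inv_mul_cancel₀ (hw k n).ne'
  · exact mul_pos (inv_pos.2 (hw k n)) (hx k _)
  · refine tendsto_pi_nhds.2 fun n => tendsto_pi_nhds.2 fun s => ?_
    simpa using ((hwlim n).inv₀ one_ne_zero).mul (hlim n s)
  · rw [ge_iff_le, ← sub_nonneg, payoff_update_sub,
      eval_advantagePoly_scale G n (σ n) sn (x k) fun m => (w k m)⁻¹]
    exact mul_nonneg (Finset.prod_nonneg fun m _ => (inv_pos.2 (hw k m)).le) (hadv k n sn)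

omit [∀ n, DecidableEq (S n)] sn τ n G in
lemma exists_eventually_box_le {σ : Profile S} {η : PolyProfile S} {l : ℕ} (hl : 0 < l)
    (hpos : ∀ n (sn : S n), polyPos (η n sn)) (hord : polyOrder η ≤ (l : ℕ∞))
    (h0 : ∀ n (sn : S n), (η n sn).eval 0 = σ n sn) {δ : ℝ} (hδ : 0 < δ) :
    ∃ c > 0, ∀ᶠ t in 𝓝[>] (0 : ℝ), ∀ p : Σ n, S n,
      max (σ p.1 p.2 - δ) 0 + c * t ^ l ≤ (η p.1 p.2).eval t := by
  have hp : ∀ p : Σ n, S n, ∃ c > 0, ∀ᶠ t in 𝓝[>] (0 : ℝ),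
      max (σ p.1 p.2 - δ) 0 + c * t ^ l ≤ (η p.1 p.2).eval t := by
    intro p
    have hlp : (η p.1 p.2).trailingDegree ≤ (l : ℕ∞) :=
      le_trans (Finset.le_sup (f := fun p : Σ n, S n => (η p.1 p.2).trailingDegree)
        (Finset.mem_univ p)) hord
    rcases le_or_gt (σ p.1 p.2) 0 with hσ0 | hσ0
    · rw [max_eq_right (by linarith)]
      simpa using eventually_pow_le_eval (hpos p.1 p.2) hlp
    · refine ⟨1, one_pos, ?_⟩
      have h1 : Tendsto (fun t : ℝ => max (σ p.1 p.2 - δ) 0 + 1 * t ^ l) (𝓝 0)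
          (𝓝 (max (σ p.1 p.2 - δ) 0 + 1 * 0 ^ l)) := Continuous.tendsto (by fun_prop) 0
      have h2 : Tendsto (fun t : ℝ => (η p.1 p.2).eval t) (𝓝 0) (𝓝 (σ p.1 p.2)) := by
        rw [← h0]; exact (η p.1 p.2).continuous.tendsto 0
      have h3 : max (σ p.1 p.2 - δ) 0 + 1 * 0 ^ l < σ p.1 p.2 := by
        rw [zero_pow hl.ne', mul_zero, add_zero]
        exact max_lt (by linarith) hσ0
      exact nhdsWithin_le_nhds ((h1.eventually_lt h2 h3).mono fun t ht => ht.le)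
  choose c hc hct using hp
  obtain ⟨c', hc', hle⟩ := exists_pos_forall_le hc
  refine ⟨c', hc', ?_⟩
  filter_upwards [eventually_all.2 hct, self_mem_nhdsWithin] with t ht ht' p
  refine le_trans ?_ (ht p)
  have : (0 : ℝ) < t := ht'
  gcongr
  exact hle p

end Game

lemma degree_bound {d κ : ℕ} (hd : 1 ≤ d) (hκ : 2 ≤ κ) :
    d * (2 * d + 2) ^ κ ≤ d * (6 * d - 3) ^ (2 * κ - 1) := by
  obtain ⟨e, rfl⟩ := Nat.exists_eq_add_of_le' hd
  obtain ⟨k, rfl⟩ := Nat.exists_eq_add_of_le' hκ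
  refine Nat.mul_le_mul_left _ ?_
  have h1 : 6 * (e + 1) - 3 = 6 * e + 3 := by omega
  have h2 : 2 * (k + 2) - 1 = 2 * k + 3 := by omega
  rw [h1, h2, pow_add, pow_add, pow_mul]
  refine Nat.mul_le_mul (Nat.pow_le_pow_left ?_ k) ?_
  · nlinarith
  · ring_nf; nlinarith [Nat.zero_le (e ^ 2), Nat.zero_le (e ^ 3)]

open Filter Topology

/-- a polynomial strategy-profile satisfying 2(a)-2(c) implies perfection. -/
theorem stmt8 {N : ℕ} (hN : 2 ≤ N) (S : Fin N → Type) [∀ n, Fintype (S n)]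
    [∀ n, DecidableEq (S n)] [∀ n, Nonempty (S n)]
    (G : Fin N → (∀ m, S m) → ℝ)
    (κ d Z D L : ℕ)
    (hκ : κ = ∑ n, Fintype.card (S n)) (hd : d = N - 1)
    (hZ : Z = (2*d+6)*(2*d+5)^(κ-1)) (hD : D = 5*(κ*(2*d+4)+2)*Z)
    (hL : L = d*(6*d-3)^(2*κ-1))
    (ℓ K : ℕ) (hℓ : ℓ = 2*d*(Z*D)^2*(1+Z)) (hK : K = L*ℓ)
    (σ : Profile S) (hσ : IsMixed σ)
    (η : PolyProfile S)
    (hpos : ∀ n (sn : S n), polyPos (η n sn)) (hord : polyOrder η ≤ (ℓ : ℕ∞))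
    (h0 : ∀ n (sn : S n), (η n sn).eval 0 = σ n sn)
    (hbr : ∀ n, polyBestReply G η n (σ n) K) :
    IsPerfect G σ := by
  have hd1 : 1 ≤ d := by omega
  have hκ2 : 2 ≤ κ := by
    have : ∑ n : Fin N, 1 ≤ ∑ n, Fintype.card (S n) :=
      Finset.sum_le_sum fun n _ => Fintype.card_pos
    simp only [Finset.sum_const, Finset.card_univ, Fintype.card_fin, smul_eq_mul, mul_one] at this
    omega
  have hcard : Fintype.card (Σ n, S n) = κ := by rw [Fintype.card_sigma, hκ]
  have hℓ0 : 0 < ℓ := by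
    have hZ0 : 0 < Z := by rw [hZ]; positivity
    have hD0 : 0 < D := by rw [hD]; positivity
    rw [hℓ]; positivity
  have hexp : ℓ * (2 * d * (2 * d + 2) ^ κ) + 1 ≤ (K + 1) * 2 := by
    have h1 := degree_bound hd1 hκ2
    rw [← hL] at h1
    rw [hK]
    nlinarith [Nat.mul_le_mul_left ℓ h1]
  refine isPerfect_of_forall_exists G hσ fun δ hδ => ?_
  by_contra! hno
  let f : (Σ n, S n) → MvPolynomial (Σ n, S n) ℝ := fun p => advantagePoly G p.1 (σ p.1) p.2
  let a : (Σ n, S n) → ℝ := fun p => max (σ p.1 p.2 - δ) 0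
  let u : (Σ n, S n) → ℝ := fun p => σ p.1 p.2 + δ
  obtain ⟨c, hc, s₀, hs₀, hbd⟩ := pow_le_violation hd1 f
    (fun p => hd ▸ totalDegree_advantagePoly_le G p.1 (σ p.1) p.2) a u
    (fun p => le_max_right _ _) (fun x hx hx' => by
      obtain ⟨n, sn, h⟩ := hno x (fun p => (le_max_right _ _).trans_lt (hx p)) fun p => by
        have h1 := (le_max_left (σ p.1 p.2 - δ) 0).trans_lt (hx p)
        have h2 : x p ≤ σ p.1 p.2 + δ := hx' p
        rw [abs_le]; constructor <;> linarith
      exact ⟨⟨n, sn⟩, h⟩)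
  rw [hcard] at hbd
  obtain ⟨c₁, hc₁, hbox⟩ := exists_eventually_box_le hℓ0 hpos hord h0 hδ
  choose C hC hCt using fun p : Σ n, S n => eventually_min_sq_le (hbr p.1 p.2)
  have hup : ∀ᶠ t in 𝓝[>] (0 : ℝ), ∀ p : Σ n, S n, (η p.1 p.2).eval t ≤ u p :=
    eventually_all.2 fun p => nhdsWithin_le_nhds <| by
      have h1 := (η p.1 p.2).continuous.tendsto 0
      rw [h0] at h1
      exact (h1.eventually_lt_const (show σ p.1 p.2 < u p by simp [u, hδ])).mono fun t ht => ht.le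
  have hsmall : ∀ᶠ t in 𝓝[>] (0 : ℝ), c₁ * t ^ ℓ < s₀ := nhdsWithin_le_nhds <| by
    have h1 : Tendsto (fun t : ℝ => c₁ * t ^ ℓ) (𝓝 0) (𝓝 (c₁ * 0 ^ ℓ)) :=
      Continuous.tendsto (by fun_prop) 0
    exact h1.eventually_lt_const (by rw [zero_pow hℓ0.ne', mul_zero]; exact hs₀)
  have hle : ∀ᶠ t in 𝓝[>] (0 : ℝ),
      c * c₁ ^ (2 * d * (2 * d + 2) ^ κ) ≤ (∑ p, C p) * t := by
    filter_upwards [hbox, hup, hsmall, eventually_all.2 hCt, Ioo_mem_nhdsGT one_pos] with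
      t h1 h2 h3 h4 h5
    have ht : 0 < t := h5.1
    have h6 := hbd (c₁ * t ^ ℓ) (by positivity) h3 (fun p => (η p.1 p.2).eval t) h1 h2
    have h7 : violation f (fun p => (η p.1 p.2).eval t) ≤ (∑ p, C p) * (t ^ (K + 1)) ^ 2 := by
      rw [violation, Finset.sum_mul]
      refine Finset.sum_le_sum fun p _ => ?_
      rw [← eval_payoffPoly_sub]
      exact h4 p
    have h8 : (t ^ (K + 1)) ^ 2 ≤ t ^ (ℓ * (2 * d * (2 * d + 2) ^ κ)) * t := by
      rw [← pow_mul, ← pow_succ]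
      exact pow_le_pow_of_le_one ht.le h5.2.le hexp
    have h9 : 0 < t ^ (ℓ * (2 * d * (2 * d + 2) ^ κ)) := by positivity
    refine le_of_mul_le_mul_right ?_ h9
    calc c * c₁ ^ (2 * d * (2 * d + 2) ^ κ) * t ^ (ℓ * (2 * d * (2 * d + 2) ^ κ))
        = c * (c₁ * t ^ ℓ) ^ (2 * d * (2 * d + 2) ^ κ) := by rw [mul_pow, ← pow_mul, mul_assoc]
      _ ≤ (∑ p, C p) * (t ^ (K + 1)) ^ 2 := h6.trans h7
      _ ≤ (∑ p, C p) * (t ^ (ℓ * (2 * d * (2 * d + 2) ^ κ)) * t) :=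
        mul_le_mul_of_nonneg_left h8 (Finset.sum_nonneg fun p _ => hC p)
      _ = (∑ p, C p) * t * t ^ (ℓ * (2 * d * (2 * d + 2) ^ κ)) := by ring
  have hlim : Tendsto (fun t : ℝ => (∑ p, C p) * t) (𝓝[>] 0) (𝓝 0) := by
    have h1 : Tendsto (fun t : ℝ => (∑ p, C p) * t) (𝓝 0) (𝓝 ((∑ p, C p) * 0)) :=
      Continuous.tendsto (by fun_prop) 0
    rw [mul_zero] at h1
    exact h1.mono_left nhdsWithin_le_nhds
  exact (mul_pos hc (pow_pos hc₁ _)).not_ge (ge_of_tendsto hlim hle)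

end GamePE
end

section
/- Let f(T, U) be a nonzero polynomial in two variables with real coefficients, let q ≥ 1 be an integer, and let v be a nonzero formal power series over ℝ in one variable t. Suppose that substituting T ↦ t^q and U ↦ v(t) into f yields the zero power series, i.e., f(t^q, v(t)) = 0 in ℝ[[t]]. Then the order of v satisfies ord(v) ≤ q · deg_T(f), where deg_T(f) is the degree of f in the variable T. -/
/-- A finite sum of power series with a unique term of minimal order, itself nonzero, is nonzero. -/
theorem PowerSeries.sum_ne_zero_of_unique_min_order {ι R : Type*} [Semiring R]
    (s : Finset ι) (g : ι → PowerSeries R) {a : ι} (ha : a ∈ s) (h0 : g a ≠ 0)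
    (hmin : ∀ b ∈ s, b ≠ a → (g a).order < (g b).order) : ∑ b ∈ s, g b ≠ 0 := by
  intro h
  apply PowerSeries.coeff_order h0
  have hc := congrArg (PowerSeries.coeff (g a).order.toNat) h
  rw [map_sum, map_zero, Finset.sum_eq_single_of_mem a ha] at hc
  · exact hc
  · intro b hb hba
    apply PowerSeries.coeff_of_lt_order
    rw [ENat.natCast_toNat (PowerSeries.order_eq_top.not.mpr h0)]
    exact hmin b hb hba

/-- if `f(T,U)` is a nonzero real polynomial in two variables, `q ≥ 1`, and a
nonzero formal power series `v` satisfies `f(t^q, v(t)) = 0`, then `ord(v) ≤ q · deg_T(f)`. -/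
theorem stmt11 (f : MvPolynomial (Fin 2) ℝ) (hf : f ≠ 0) (q : ℕ) (hq : 1 ≤ q)
    (v : PowerSeries ℝ) (hv : v ≠ 0)
    (hroot : MvPolynomial.aeval ![(PowerSeries.X : PowerSeries ℝ) ^ q, v] f = 0) :
    v.order ≤ ((q * f.degreeOf 0 : ℕ) : ℕ∞) := by
  by_contra! hlt
  obtain ⟨n, hn⟩ := ENat.ne_top_iff_exists.mp (PowerSeries.order_eq_top.not.mpr hv)
  rw [← hn, Nat.cast_lt] at hlt
  let g : (Fin 2 →₀ ℕ) → PowerSeries ℝ := fun s =>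
    PowerSeries.C (f.coeff s) * ((PowerSeries.X ^ q) ^ s 0 * v ^ s 1)
  have hsum : ∑ s ∈ f.support, g s = 0 := by
    rw [← hroot, MvPolynomial.aeval_def, MvPolynomial.eval₂_eq']
    simp [g, Fin.prod_univ_two]
  have hCne : ∀ s ∈ f.support, PowerSeries.C (f.coeff s) ≠ 0 := fun s hs =>
    (map_ne_zero_iff _ PowerSeries.C_injective).mpr (MvPolynomial.mem_support_iff.mp hs)
  have hgne : ∀ s ∈ f.support, g s ≠ 0 := fun s hs =>
    mul_ne_zero (hCne s hs)
      (mul_ne_zero (pow_ne_zero _ (pow_ne_zero _ PowerSeries.X_ne_zero)) (pow_ne_zero _ hv))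
  have hord : ∀ s ∈ f.support, (g s).order = ((q * s 0 + n * s 1 : ℕ) : ℕ∞) := by
    intro s hs
    have hC : (PowerSeries.C (f.coeff s)).order = 0 := by
      apply PowerSeries.order_zero_of_unit
      exact (isUnit_iff_ne_zero.mpr (MvPolynomial.mem_support_iff.mp hs)).map PowerSeries.C
    simp only [g, PowerSeries.order_mul, hC, PowerSeries.order_pow, PowerSeries.order_X, ← hn]
    push_cast
    simp [mul_comm]
  have hdeg : ∀ s ∈ f.support, q * s 0 < n := fun s hs =>
    (Nat.mul_le_mul_left q (MvPolynomial.monomial_le_degreeOf 0 hs)).trans_lt hlt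
  obtain ⟨a, ha, hmin⟩ := f.support.exists_min_image (fun s => q * s 0 + n * s 1)
    (MvPolynomial.support_nonempty.mpr hf)
  refine PowerSeries.sum_ne_zero_of_unique_min_order f.support g ha (hgne a ha) ?_ hsum
  intro b hb hba
  rw [hord a ha, hord b hb, Nat.cast_lt]
  refine lt_of_le_of_ne (hmin b hb) fun heq => hba ?_
  have hn0 : 0 < n := (Nat.zero_le _).trans_lt hlt
  have h1 : b 1 = a 1 := by
    have := congrArg (· / n) heq
    simpa [Nat.add_mul_div_left _ _ hn0, Nat.div_eq_of_lt (hdeg a ha),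
      Nat.div_eq_of_lt (hdeg b hb)] using this.symm
  have h0 : b 0 = a 0 := by
    rw [h1] at heq
    exact (Nat.eq_of_mul_eq_mul_left hq (Nat.add_right_cancel heq)).symm
  ext i
  fin_cases i
  · exact h0
  · exact h1
end
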